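/- Fix 1 ≤ i ≤ n and let A be a spline on (G, m, r) with A(v_s) = 0 for all s < i. Then for every vertex v_u with u ≥ i and every trail W from v_u to v_i all of whose vertices lie in {v_i, …, v_n}, the integer gcd( lcm( m(v_u), lcm of the labels r(v_u v_s) over all edges v_u v_s of G with s < i ), g(W) ) divides A(v_i). -/

import Mathlib

/-- `g(W)`: the gcd of the edge labels traversed by a walk `W`
(equal to `0` for a walk with no edges). -/
def walkGcd {V : Type*} {G : SimpleGraph V} (r : V → V → ℤ) {u v : V}
    (W : G.Walk u v) : ℤ :=
  (W.darts.map (fun d => r d.toProd.1 d.toProd.2)).foldr gcd 0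

/-- The gcd of the edge labels along a walk divides the difference of the values at its endpoints
of any function whose difference along each edge is divisible by the label of that edge. -/
theorem walkGcd_dvd_sub {V : Type*} {G : SimpleGraph V} {r : V → V → ℤ} {A : V → ℤ}
    (hA : ∀ u w, G.Adj u w → r u w ∣ A u - A w) {u v : V} (W : G.Walk u v) :
    walkGcd r W ∣ A u - A v := by
  induction W with
  | nil => simp
  | @cons u w v h W ih =>
    have hstep : walkGcd r (SimpleGraph.Walk.cons h W) = gcd (r u w) (walkGcd r W) := by
      simp [walkGcd]
    rw [hstep, ← sub_add_sub_cancel (A u) (A w) (A v)]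
    exact dvd_add ((gcd_dvd_left _ _).trans (hA u w h)) ((gcd_dvd_right _ _).trans ih)

/-- fix `i` and a spline `A` vanishing below `i`. Then for every
vertex `u ≥ i` and every trail `W` from `u` to `i` all of whose vertices lie in
`{v_i, …, v_n}`, the integer
`gcd (lcm (m u) (lcm of r (u, s) over edges u-s with s < i)) (g W)`
divides `A i`. -/
theorem reduced_trail_gcd_dvd {n : ℕ} (G : SimpleGraph (Fin n))
    [DecidableRel G.Adj]
    (m : Fin n → ℤ) (r : Fin n → Fin n → ℤ) (hr : ∀ u w, r u w = r w u)
    (i : Fin n) (A : Fin n → ℤ)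
    (hspline : (∀ v, m v ∣ A v) ∧ ∀ u w, G.Adj u w → r u w ∣ A u - A w)
    (hzero : ∀ s, s < i → A s = 0)
    (u : Fin n) (hu : i ≤ u) (W : G.Walk u i) (hW : W.IsTrail)
    (hsupp : ∀ x ∈ W.support, i ≤ x) :
    gcd
      (lcm (m u) ((Finset.univ.filter (fun s => G.Adj u s ∧ s < i)).lcm (r u)))
      (walkGcd r W)
    ∣ A i := by
  obtain ⟨hm, he⟩ := hspline
  have hu_dvd : lcm (m u) ((Finset.univ.filter (fun s => G.Adj u s ∧ s < i)).lcm (r u)) ∣ A u := by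
    refine lcm_dvd (hm u) (Finset.lcm_dvd fun s hs => ?_)
    obtain ⟨hadj, hs⟩ := (Finset.mem_filter.mp hs).2
    simpa [hzero s hs] using he u s hadj
  rw [← sub_sub_cancel (A u) (A i)]
  exact dvd_sub ((gcd_dvd_left _ _).trans hu_dvd)
    ((gcd_dvd_right _ _).trans (walkGcd_dvd_sub he W))
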